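/- For every integer j, s_j = σ^j·h + 2·ρ^(j/2)·(g·cos(jθ) − k·sin(jθ)) as vectors in ℝ³. -/

import Mathlib

noncomputable def cbrt2 : ℝ := (2 : ℝ) ^ ((1 : ℝ) / 3)
noncomputable def cbrt4 : ℝ := (2 : ℝ) ^ ((2 : ℝ) / 3)
noncomputable def σ : ℝ := cbrt2 - 1
noncomputable def ρ : ℝ := 1 + cbrt2 + cbrt4

def S : Matrix (Fin 3) (Fin 3) ℝ := !![0, 0, 1; 1, 0, -3; 0, 1, -3]

noncomputable def h : Fin 3 → ℝ :=
  (1 / 6 : ℝ) • ![cbrt2, 2 - 2 * cbrt2 + cbrt4, -cbrt2 + cbrt4]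

noncomputable def g : Fin 3 → ℝ :=
  (1 / 12 : ℝ) • ![-cbrt2, 4 + 2 * cbrt2 - cbrt4, cbrt2 - cbrt4]

noncomputable def k : Fin 3 → ℝ :=
  (Real.sqrt 3 / 12) • ![cbrt2, -2 * cbrt2 - cbrt4, -cbrt2 - cbrt4]

noncomputable def θ : ℝ := Real.pi - Real.arctan (Real.sqrt 3 * cbrt2 / (2 + cbrt2))

lemma cbrt2_pos : 0 < cbrt2 := Real.rpow_pos_of_pos two_pos _

lemma cbrt4_eq : cbrt4 = cbrt2 ^ 2 := by
  rw [cbrt4, cbrt2, ← Real.rpow_natCast, ← Real.rpow_mul zero_le_two]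
  norm_num

lemma cbrt2_cube : cbrt2 ^ 3 = 2 := by
  rw [cbrt2, ← Real.rpow_natCast, ← Real.rpow_mul zero_le_two]
  norm_num

lemma σ_ne_zero : σ ≠ 0 := by
  intro h0
  have hc : cbrt2 = 1 := by unfold σ at h0; linarith
  have := cbrt2_cube
  norm_num [hc] at this

lemma ρ_pos : 0 < ρ := by
  have := cbrt2_pos
  rw [ρ, cbrt4_eq]
  positivity

lemma sqrt_one_add_sq_tan :
    √(1 + (√3 * cbrt2 / (2 + cbrt2)) ^ 2) = 2 * √ρ / (2 + cbrt2) := by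
  have hc := cbrt2_pos
  have h3 : √(3 : ℝ) ^ 2 = 3 := Real.sq_sqrt (by norm_num)
  rw [Real.sqrt_eq_iff_mul_self_eq (by positivity) (by positivity)]
  have hρ : √ρ ^ 2 = 1 + cbrt2 + cbrt2 ^ 2 := by
    rw [Real.sq_sqrt ρ_pos.le, ρ, cbrt4_eq]
  field_simp
  rw [h3, hρ]
  ring

/-- The real part of the complex eigenvalue of `S` with modulus `√ρ` and argument `θ`. -/
lemma sqrt_ρ_mul_cos_θ : √ρ * Real.cos θ = -(2 + cbrt2) / 2 := by
  have hc := cbrt2_pos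
  have hρ := Real.sqrt_pos.2 ρ_pos
  rw [θ, Real.cos_pi_sub, Real.cos_arctan, sqrt_one_add_sq_tan]
  field_simp

/-- The imaginary part of the complex eigenvalue of `S` with modulus `√ρ` and argument `θ`. -/
lemma sqrt_ρ_mul_sin_θ : √ρ * Real.sin θ = √3 * cbrt2 / 2 := by
  have hc := cbrt2_pos
  have hρ := Real.sqrt_pos.2 ρ_pos
  rw [θ, Real.sin_pi_sub, Real.sin_arctan, sqrt_one_add_sq_tan]
  field_simp

lemma S_mulVec (v : Fin 3 → ℝ) :
    S.mulVec v = ![v 2, v 0 - 3 * v 2, v 1 - 3 * v 2] := by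
  ext i
  fin_cases i <;> simp [S, Matrix.mulVec, dotProduct, Fin.sum_univ_three] <;> ring

lemma S_mulVec_injective : Function.Injective S.mulVec := by
  intro v w hvw
  simp only [S_mulVec] at hvw
  have h0 := congrFun hvw 0
  have h1 := congrFun hvw 1
  have h2 := congrFun hvw 2
  simp only [Matrix.cons_val] at h0 h1 h2
  ext i
  fin_cases i <;> simp only [Fin.zero_eta, Fin.mk_one, Fin.reduceFinMk] <;> linarith

lemma S_mulVec_h : S.mulVec h = σ • h := by
  have hc := cbrt2_cube
  rw [S_mulVec]
  ext i
  fin_cases i <;> simp [h, σ, cbrt4_eq] <;> grind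

lemma S_mulVec_g :
    S.mulVec g = (√ρ * Real.cos θ) • g - (√ρ * Real.sin θ) • k := by
  have hc := cbrt2_cube
  have h3 : √(3 : ℝ) ^ 2 = 3 := Real.sq_sqrt (by norm_num)
  rw [S_mulVec, sqrt_ρ_mul_cos_θ, sqrt_ρ_mul_sin_θ]
  ext i
  fin_cases i <;> simp [g, k, cbrt4_eq] <;> grind

lemma S_mulVec_k :
    S.mulVec k = (√ρ * Real.sin θ) • g + (√ρ * Real.cos θ) • k := by
  have hc := cbrt2_cube
  rw [S_mulVec, sqrt_ρ_mul_cos_θ, sqrt_ρ_mul_sin_θ]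
  ext i
  fin_cases i <;> simp [g, k, cbrt4_eq] <;> grind

/-- The spectral expansion obeys the recurrence `s (j + 1) = S (s j)`. -/
lemma S_mulVec_expansion (j : ℤ) :
    S.mulVec (σ ^ j • h + (2 * ρ ^ ((j : ℝ) / 2)) •
        (Real.cos (j * θ) • g - Real.sin (j * θ) • k)) =
      σ ^ (j + 1) • h + (2 * ρ ^ (((j + 1 : ℤ) : ℝ) / 2)) •
        (Real.cos ((j + 1 : ℤ) * θ) • g - Real.sin ((j + 1 : ℤ) * θ) • k) := by
  have hρ : ρ ^ (((j + 1 : ℤ) : ℝ) / 2) = ρ ^ ((j : ℝ) / 2) * √ρ := by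
    rw [Real.sqrt_eq_rpow, ← Real.rpow_add ρ_pos]
    push_cast
    ring_nf
  have hθ : ((j + 1 : ℤ) : ℝ) * θ = j * θ + θ := by push_cast; ring
  rw [hρ, hθ, Real.cos_add, Real.sin_add, zpow_add_one₀ σ_ne_zero]
  simp only [Matrix.mulVec_add, Matrix.mulVec_sub, Matrix.mulVec_smul, S_mulVec_h, S_mulVec_g,
    S_mulVec_k]
  module

lemma expansion_zero : h + (2 : ℝ) • g = ![0, 1, 0] := by
  ext i
  fin_cases i <;> simp [h, g] <;> ring

theorem s_j_spectral_expansion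
    (s : ℤ → (Fin 3 → ℝ))
    (hs0 : s 0 = ![0, 1, 0])
    (hs : ∀ j : ℤ, s (j + 1) = S.mulVec (s j)) :
    ∀ j : ℤ,
      s j = σ ^ j • h +
        (2 * ρ ^ ((j : ℝ) / 2)) •
          (Real.cos (j * θ) • g - Real.sin (j * θ) • k) := by
  intro j
  induction j using Int.induction_on with
  | zero => simpa [hs0] using expansion_zero.symm
  | succ n ih => rw [hs, ih, S_mulVec_expansion]
  | pred n ih =>
    apply S_mulVec_injective
    rw [← hs, S_mulVec_expansion, sub_add_cancel, ih]
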